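/- arXiv:2308.08519 — 3 statements merged into one kernel-verified Lean document; each statement's English description precedes it below -/
import Mathlib

section
/- Let P be a small additive category, I ⊆ P a full additive subcategory, and d ≥ 1. Let K be the homotopy category of bounded cochain complexes over P with shift Σ, identify P with complexes in degree 0, set A^{(d)} := (P ∗ ΣP ∗ ⋯ ∗ Σ^d P) ∩ { X : Hom_K(X, Σ^m I) = 0 for all I ∈ I, m ≥ 1 } and A^{(d+1)} analogously with d+1 shifts. Assume I is covariantly finite in A^{(d)} (every X ∈ A^{(d)} admits a left I-approximation). Then the following are equivalent: (a) Hom_K(X, Σ^{-n} Y) = 0 for all X, Y ∈ A^{(d+1)} and all n ≥ 1; (b) both of the following hold: (2) for each object P ∈ P there exist I ∈ I and a morphism f : P → I such that the induced map Hom_P(Q, P) → Hom_P(Q, I) is injective for every Q ∈ P; and (3) for every complex 0 → P_{d+1} → P_d → ⋯ → P_1 → P_0 over P such that Hom_P(P_0, I) → ⋯ → Hom_P(P_{d+1}, I) → 0 is exact for every I ∈ I, the sequence 0 → Hom_P(Q, P_{d+1}) → ⋯ → Hom_P(Q, P_1) → Hom_P(Q, P_0) is exact for every Q ∈ P. -/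
/-!
Statement 8: Let `P` be a small additive category, `I ⊆ P` a full additive subcategory,
`d ≥ 1`, and `K` the homotopy category of (bounded) complexes over `P`. Assume `I` is
covariantly finite in `A^{(d)}`. Then `Hom_K(X, Σ^{-n}Y) = 0` for all `X, Y ∈ A^{(d+1)}`
and `n ≥ 1` if and only if (2) every `P ∈ P` admits a map to some `I ∈ I` inducing an
injection `Hom(Q,P) → Hom(Q,I)` for all `Q`, and (3) every complex
`0 → P_{d+1} → ⋯ → P_0` over `P` whose `Hom(-, I)`-sequence is exact for every `I ∈ I`
has its `Hom(Q, -)`-sequence `0 → Hom(Q,P_{d+1}) → ⋯ → Hom(Q,P_0)` exact for all `Q`.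
-/

open CategoryTheory Limits Pretriangulated

universe v u

namespace AuslanderIyamaStmt8

section Generic

variable {C : Type u} [Category.{v} C] [HasZeroObject C] [HasShift C ℤ] [Preadditive C]
  [∀ n : ℤ, (shiftFunctor C n).Additive] [Pretriangulated C]

/-- `S₁ ∗ S₂`: objects `Y` fitting in a distinguished triangle `X ⟶ Y ⟶ Z ⟶ X⟦1⟧`
with `X ∈ S₁` and `Z ∈ S₂`. -/
def star (S₁ S₂ : Set C) : Set C :=
  {Y | ∃ (X Z : C) (f : X ⟶ Y) (g : Y ⟶ Z) (h : Z ⟶ X⟦(1 : ℤ)⟧),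
    (Triangle.mk f g h ∈ distTriang C) ∧ X ∈ S₁ ∧ Z ∈ S₂}

/-- `Σⁿ S`, closed under isomorphism. -/
def shiftSet (n : ℤ) (S : Set C) : Set C :=
  {X | ∃ Y ∈ S, Nonempty (X ≅ Y⟦n⟧)}

/-- `V n = P ∗ ΣP ∗ ⋯ ∗ Σⁿ P`. -/
def V (P : Set C) : ℕ → Set C
  | 0 => P
  | n + 1 => star (V P n) (shiftSet ((n : ℤ) + 1) P)

/-- The kernel class `{X : Hom(X, Σ^m I') = 0 for all I' ∈ I, m ≥ 1}`. -/
def extKer (I : Set C) : Set C :=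
  {X | ∀ I' ∈ I, ∀ m : ℤ, 1 ≤ m → ∀ f : X ⟶ I'⟦m⟧, f = 0}

end Generic

variable (P : Type u) [SmallCategory P] [Preadditive P] [HasZeroObject P]
  [HasBinaryBiproducts P]

/-- The identification of `P` with the complexes concentrated in degree `0`, regarded
in the homotopy category. -/
noncomputable def emb : P ⥤ HomotopyCategory P (ComplexShape.up ℤ) :=
  HomologicalComplex.single P (ComplexShape.up ℤ) 0 ⋙
    HomotopyCategory.quotient P (ComplexShape.up ℤ)

/-- The class of objects of the homotopy category isomorphic to an object of `P`
placed in degree `0`. -/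
noncomputable def Pclass : Set (HomotopyCategory P (ComplexShape.up ℤ)) :=
  {X | ∃ p : P, Nonempty (X ≅ (emb P).obj p)}

/-- The class of objects of the homotopy category isomorphic to an object of `I`
placed in degree `0`. -/
noncomputable def Iclass (I : Set P) : Set (HomotopyCategory P (ComplexShape.up ℤ)) :=
  {X | ∃ p ∈ I, Nonempty (X ≅ (emb P).obj p)}

/-- `I` is covariantly finite in `S`: every `X ∈ S` admits a left `I`-approximation. -/
def CovFin {C : Type*} [Category C] (I S : Set C) : Prop :=
  ∀ X ∈ S, ∃ I₀ ∈ I, ∃ f : X ⟶ I₀, ∀ I' ∈ I, ∀ g : X ⟶ I', ∃ h : I₀ ⟶ I', f ≫ h = g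

variable {P}

/-- For a complex `0 → P_{d+1} → ⋯ → P_0` over `P`, given by objects `N k` and maps
`φ k : N (k+1) ⟶ N k` for `0 ≤ k ≤ d`, exactness of
`Hom(N 0, I) → Hom(N 1, I) → ⋯ → Hom(N (d+1), I) → 0`. -/
def finRightExact (d : ℕ) (N : ℕ → P) (φ : ∀ k, N (k + 1) ⟶ N k) (I : P) : Prop :=
  (∀ j, j < d → ∀ g : N (j + 1) ⟶ I, φ (j + 1) ≫ g = 0 → ∃ h : N j ⟶ I, φ j ≫ h = g) ∧
    ∀ g : N (d + 1) ⟶ I, ∃ h : N d ⟶ I, φ d ≫ h = g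

/-- For a complex `0 → P_{d+1} → ⋯ → P_0` over `P`, given by objects `N k` and maps
`φ k : N (k+1) ⟶ N k` for `0 ≤ k ≤ d`, exactness of
`0 → Hom(Q, N (d+1)) → Hom(Q, N d) → ⋯ → Hom(Q, N 1) → Hom(Q, N 0)`. -/
def finLeftExact (d : ℕ) (N : ℕ → P) (φ : ∀ k, N (k + 1) ⟶ N k) (Q : P) : Prop :=
  (∀ g g' : Q ⟶ N (d + 1), g ≫ φ d = g' ≫ φ d → g = g') ∧
    ∀ j, j < d → ∀ g : Q ⟶ N (j + 1), g ≫ φ j = 0 →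
      ∃ h : Q ⟶ N (j + 2), h ≫ φ (j + 1) = g

variable (P)

set_option linter.unusedSectionVars false

section HomVanishing

open CochainComplex HomComplex

variable {P}

lemma forall_hom_emb_shift_eq_zero_iff (K : CochainComplex P ℤ) (Q : P) (n r s : ℤ)
    (hr : r + 1 = n) (hs : n + 1 = s) :
    (∀ f : (emb P).obj Q ⟶ ((HomotopyCategory.quotient P (ComplexShape.up ℤ)).obj K)⟦n⟧,
      f = 0) ↔
      ∀ g : Q ⟶ K.X n, g ≫ K.d n s = 0 → ∃ h : Q ⟶ K.X r, h ≫ K.d r n = g := by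
  let e := ((HomotopyCategory.quotient P (ComplexShape.up ℤ)).commShiftIso n).app K
  have key : (∀ f : (emb P).obj Q ⟶
      ((HomotopyCategory.quotient P (ComplexShape.up ℤ)).obj K)⟦n⟧, f = 0) ↔
      ∀ x : Cocycle ((singleFunctor P 0).obj Q) K n, x ∈ coboundaries _ _ _ := by
    constructor
    · intro H x
      rw [← CohomologyClass.toHom_mk_eq_zero_iff, ← cancel_mono e.hom, zero_comp]
      exact H _
    · intro H f
      obtain ⟨y, hy⟩ := (CohomologyClass.toHom_bijective ((singleFunctor P 0).obj Q) K n).2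
        (f ≫ e.inv)
      obtain ⟨x, rfl⟩ := y.mk_surjective
      rw [(CohomologyClass.toHom_mk_eq_zero_iff x).2 (H x)] at hy
      rw [← cancel_mono e.inv, zero_comp]
      exact hy.symm
  rw [key]
  constructor
  · intro H g hg
    exact (Cocycle.fromSingleMk_mem_coboundaries_iff g (zero_add n) s hs hg r hr).1 (H _)
  · intro H x
    obtain ⟨g, hg, rfl⟩ := Cocycle.fromSingleMk_surjective x n (zero_add n) s hs
    exact (Cocycle.fromSingleMk_mem_coboundaries_iff g (zero_add n) s hs hg r hr).2 (H g hg)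

lemma forall_hom_to_emb_shift_eq_zero_iff (K : CochainComplex P ℤ) (J : P) (m n r s : ℤ)
    (hm : n + m = 0) (hr : r + 1 = n) (hs : n + 1 = s) :
    (∀ f : (HomotopyCategory.quotient P (ComplexShape.up ℤ)).obj K ⟶ ((emb P).obj J)⟦m⟧,
      f = 0) ↔
      ∀ g : K.X n ⟶ J, K.d r n ≫ g = 0 → ∃ h : K.X s ⟶ J, K.d n s ≫ h = g := by
  let e := ((HomotopyCategory.quotient P (ComplexShape.up ℤ)).commShiftIso m).app
    ((singleFunctor P 0).obj J)
  have key : (∀ f : (HomotopyCategory.quotient P (ComplexShape.up ℤ)).obj K ⟶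
      ((emb P).obj J)⟦m⟧, f = 0) ↔
      ∀ x : Cocycle K ((singleFunctor P 0).obj J) m, x ∈ coboundaries _ _ _ := by
    constructor
    · intro H x
      rw [← CohomologyClass.toHom_mk_eq_zero_iff, ← cancel_mono e.hom, zero_comp]
      exact H _
    · intro H f
      obtain ⟨y, hy⟩ := (CohomologyClass.toHom_bijective K ((singleFunctor P 0).obj J) m).2
        (f ≫ e.inv)
      obtain ⟨x, rfl⟩ := y.mk_surjective
      rw [(CohomologyClass.toHom_mk_eq_zero_iff x).2 (H x)] at hy
      exact (cancel_mono e.inv).1 (hy.symm.trans zero_comp.symm)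
  rw [key]
  constructor
  · intro H g hg
    exact (Cocycle.toSingleMk_mem_coboundaries_iff g hm r hr hg s hs).1 (H _)
  · intro H x
    obtain ⟨g, hg, rfl⟩ := Cocycle.toSingleMk_surjective x n hm r hr
    exact (Cocycle.toSingleMk_mem_coboundaries_iff g hm r hr hg s hs).2 (H g hg)

end HomVanishing

section Truncation

open CochainComplex HomologicalComplex

variable {P}

lemma stupidTrunc_d {c : ComplexShape ℕ} (K : CochainComplex P ℤ)
    (e : c.Embedding (ComplexShape.up ℤ)) [e.IsRelIff] {i j : ℕ} {i' j' : ℤ}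
    (hi : e.f i = i') (hj : e.f j = j') :
    (K.stupidTrunc e).d i' j' =
      (K.stupidTruncXIso e hi).hom ≫ K.d i' j' ≫ (K.stupidTruncXIso e hj).inv := by
  subst hi hj
  have h (k : ℕ) : K.stupidTruncXIso e (rfl : e.f k = e.f k) =
      (K.restriction e).extendXIso e rfl := Iso.ext (Category.comp_id _)
  rw [h, h]
  exact extend_d_eq _ e rfl rfl

/-- The isomorphism between a brutal truncation and the original complex in the degrees
which are kept. -/
noncomputable def stupidTruncGEXIso (K : CochainComplex P ℤ) (a i : ℤ) (hi : a ≤ i) :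
    (K.stupidTrunc (ComplexShape.embeddingUpIntGE a)).X i ≅ K.X i :=
  K.stupidTruncXIso (ComplexShape.embeddingUpIntGE a) (i := (i - a).toNat) (by
    change a + ((i - a).toNat : ℤ) = i
    lia)

lemma stupidTruncGE_d (K : CochainComplex P ℤ) (a i j : ℤ) (hi : a ≤ i) (hj : a ≤ j) :
    (K.stupidTrunc (ComplexShape.embeddingUpIntGE a)).d i j =
      (stupidTruncGEXIso K a i hi).hom ≫ K.d i j ≫ (stupidTruncGEXIso K a j hj).inv :=
  stupidTrunc_d _ _ _ _

/-- The inclusion of the brutal truncation in degrees `≥ a`. -/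
noncomputable def stupidTruncGEι (K : CochainComplex P ℤ) (a : ℤ) :
    K.stupidTrunc (ComplexShape.embeddingUpIntGE a) ⟶ K where
  f i := if hi : a ≤ i then (stupidTruncGEXIso K a i hi).hom else 0
  comm' i j hij := by
    have hij : i + 1 = j := hij
    by_cases hi : a ≤ i
    · have hj : a ≤ j := by lia
      simp [hi, hj, stupidTruncGE_d K a i j hi hj]
    · exact (isZero_of_isStrictlyGE _ a i (by lia)).eq_of_src _ _

lemma stupidTruncGEι_f (K : CochainComplex P ℤ) (a i : ℤ) (hi : a ≤ i) :
    (stupidTruncGEι K a).f i = (stupidTruncGEXIso K a i hi).hom := by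
  simp [stupidTruncGEι, hi]

/-- The shift of a complex concentrated in degree `0`, as a complex concentrated in
another degree. -/
noncomputable def quotientSingleIso (p : P) (n a : ℤ) (h : n + a = 0) :
    (HomotopyCategory.quotient P (ComplexShape.up ℤ)).obj ((singleFunctor P a).obj p) ≅
      ((emb P).obj p)⟦n⟧ :=
  (((HomotopyCategory.singleFunctors P).shiftIso n a 0 h).app p).symm

lemma exists_triangle_of_isStrictlyGE (K : CochainComplex P ℤ) (a b : ℤ) (hab : b + 1 = a)
    [K.IsStrictlyGE b] :
    ∃ (f : (HomotopyCategory.quotient P (ComplexShape.up ℤ)).obj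
          (K.stupidTrunc (ComplexShape.embeddingUpIntGE a)) ⟶
          (HomotopyCategory.quotient P (ComplexShape.up ℤ)).obj K)
      (g : (HomotopyCategory.quotient P (ComplexShape.up ℤ)).obj K ⟶
        (HomotopyCategory.quotient P (ComplexShape.up ℤ)).obj
          ((singleFunctor P b).obj (K.X b)))
      (h : _ ⟶ _), Triangle.mk f g h ∈ distTriang _ := by
  let π : K ⟶ (singleFunctor P b).obj (K.X b) :=
    mkHomToSingle (𝟙 _) (fun i (hi : i + 1 = b) ↦
      (K.isZero_of_isStrictlyGE b i (by lia)).eq_of_src _ _)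
  let S : ShortComplex (CochainComplex P ℤ) := ShortComplex.mk (stupidTruncGEι K a) π (by
    ext i
    by_cases hi : i = b
    · exact (isZero_of_isStrictlyGE _ a i (by lia)).eq_of_src _ _
    · exact (isZero_single_obj_X _ _ _ _ hi).eq_of_tgt _ _)
  have σ (n : ℤ) : (S.map (eval P _ n)).Splitting :=
    if hn : a ≤ n then
      .ofIsIsoOfIsZero _ (by
        change IsIso ((stupidTruncGEι K a).f n)
        rw [stupidTruncGEι_f K a n hn]
        infer_instance) (isZero_single_obj_X (ComplexShape.up ℤ) b (K.X b) n (by lia))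
    else
      .ofIsZeroOfIsIso _ (isZero_of_isStrictlyGE
          (K.stupidTrunc (ComplexShape.embeddingUpIntGE a)) a n (by lia)) (by
        change IsIso (π.f n)
        by_cases hn' : n = b
        · subst hn'
          have hπ : π.f n = (singleObjXSelf (ComplexShape.up ℤ) n (K.X n)).inv :=
            (mkHomToSingle_f _ _).trans (Category.id_comp _)
          rw [hπ]
          exact Iso.isIso_inv (singleObjXSelf (ComplexShape.up ℤ) n (K.X n))
        · exact (K.isZero_of_isStrictlyGE b n (by lia)).isIso
            (isZero_single_obj_X _ _ _ _ hn') (π.f n))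
  exact ⟨_, _, _, (HomotopyCategory.distinguished_iff_iso_trianglehOfDegreewiseSplit _).2
    ⟨S, σ, ⟨Iso.refl _⟩⟩⟩

lemma quotient_mem_V (m : ℕ) (K : CochainComplex P ℤ) [K.IsStrictlyGE (-(m : ℤ))]
    [K.IsStrictlyLE 0] :
    (HomotopyCategory.quotient P (ComplexShape.up ℤ)).obj K ∈ V (Pclass P) m := by
  induction m generalizing K with
  | zero =>
    have : K.IsStrictlyGE 0 := by simpa using ‹K.IsStrictlyGE (-((0 : ℕ) : ℤ))›
    obtain ⟨p, ⟨e⟩⟩ := K.exists_iso_single 0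
    exact ⟨p, ⟨(HomotopyCategory.quotient P (ComplexShape.up ℤ)).mapIso e⟩⟩
  | succ m ih =>
    obtain ⟨f, g, h, hT⟩ := exists_triangle_of_isStrictlyGE K (-(m : ℤ))
      (-((m + 1 : ℕ) : ℤ)) (by push_cast; ring)
    exact ⟨_, _, f, g, h, hT, ih _, _, ⟨_, ⟨Iso.refl _⟩⟩,
      ⟨quotientSingleIso _ _ _ (by push_cast; ring)⟩⟩

lemma exists_iso_quotient_of_mem_V (m : ℕ) (X : HomotopyCategory P (ComplexShape.up ℤ))
    (hX : X ∈ V (Pclass P) m) :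
    ∃ (K : CochainComplex P ℤ) (_ : K.IsStrictlyGE (-(m : ℤ))) (_ : K.IsStrictlyLE 0),
      Nonempty (X ≅ (HomotopyCategory.quotient P (ComplexShape.up ℤ)).obj K) := by
  induction m generalizing X with
  | zero =>
    obtain ⟨p, ⟨e⟩⟩ := hX
    exact ⟨(singleFunctor P 0).obj p, by
      simpa using (inferInstance : ((singleFunctor P 0).obj p).IsStrictlyGE 0),
      inferInstance, ⟨e⟩⟩
  | succ m ih =>
    obtain ⟨X₁, Z, f, g, h, hT, hX₁, Y, ⟨p, ⟨e₁⟩⟩, ⟨e₂⟩⟩ := hX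
    obtain ⟨K, hK, hK', ⟨eK⟩⟩ := ih X₁ hX₁
    let q := HomotopyCategory.quotient P (ComplexShape.up ℤ)
    let eZ : Z ≅ q.obj ((singleFunctor P (-((m : ℤ) + 1))).obj p) :=
      e₂ ≪≫ (CategoryTheory.shiftFunctor _ ((m : ℤ) + 1)).mapIso e₁ ≪≫
        (quotientSingleIso p _ _ (add_neg_cancel _)).symm
    let eX : X₁⟦(1 : ℤ)⟧ ≅ q.obj (K⟦(1 : ℤ)⟧) :=
      (CategoryTheory.shiftFunctor _ (1 : ℤ)).mapIso eK ≪≫ ((q.commShiftIso (1 : ℤ)).app K).symm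
    obtain ⟨φ, hφ⟩ := q.map_surjective (eZ.inv ≫ h ≫ eX.hom)
    let e := isoTriangleOfIso₁₂ _ _ (rot_of_distTriang _ (rot_of_distTriang _ hT))
      (HomotopyCategory.mappingCone_triangleh_distinguished φ) eZ eX (by
        change h ≫ eX.hom = eZ.hom ≫ q.map φ
        simp [hφ])
    let e₃ : X⟦(1 : ℤ)⟧ ≅ q.obj (mappingCone φ) := Triangle.π₃.mapIso e
    have hc (i : ℤ) (hi : i + 1 < -((m : ℤ) + 1) ∨ 0 < i + 1) :
        IsZero ((mappingCone φ).X i) := by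
      rw [mappingCone.isZero_X_iff]
      exact ⟨isZero_single_obj_X _ _ _ _ (by lia), by
        obtain hi | hi := hi
        · exact K.isZero_of_isStrictlyGE (-(m : ℤ)) (i + 1) (by lia)
        · exact K.isZero_of_isStrictlyLE 0 (i + 1) (by lia)⟩
    refine ⟨(mappingCone φ)⟦(-1 : ℤ)⟧, ?_, ?_, ⟨?_⟩⟩
    · rw [isStrictlyGE_iff]
      intro i hi
      exact hc (i + -1) (by push_cast at hi; lia)
    · rw [isStrictlyLE_iff]
      intro i hi
      exact hc (i + -1) (by lia)
    · exact (shiftShiftNeg X (1 : ℤ)).symm ≪≫ (CategoryTheory.shiftFunctor _ (-1 : ℤ)).mapIso e₃ ≪≫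
        ((q.commShiftIso (-1 : ℤ)).app _).symm

end Truncation

section Vanishing

variable {P}

lemma hom_shift_neg_eq_zero_of_mem_V (Y : HomotopyCategory P (ComplexShape.up ℤ))
    (H : ∀ (Q : P) (n : ℤ), 1 ≤ n → ∀ f : (emb P).obj Q ⟶ Y⟦-n⟧, f = 0) (m : ℕ)
    (X : HomotopyCategory P (ComplexShape.up ℤ)) (hX : X ∈ V (Pclass P) m) (n : ℤ)
    (hn : 1 ≤ n) (f : X ⟶ Y⟦-n⟧) : f = 0 := by
  induction m generalizing X with
  | zero =>
    obtain ⟨p, ⟨e⟩⟩ := hX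
    rw [← cancel_epi e.inv, comp_zero]
    exact H p n hn _
  | succ m ih =>
    obtain ⟨X₁, Z, u, v, w, hT, hX₁, A, ⟨p, ⟨e₁⟩⟩, ⟨e₂⟩⟩ := hX
    obtain ⟨g, hg⟩ : ∃ g : Z ⟶ Y⟦-n⟧, f = v ≫ g := Triangle.yoneda_exact₂ _ hT f (ih X₁ hX₁ _)
    let i : Y⟦-n⟧ ≅ (Y⟦-(n + ((m : ℤ) + 1))⟧)⟦(m : ℤ) + 1⟧ :=
      (shiftFunctorAdd' _ (-(n + ((m : ℤ) + 1))) ((m : ℤ) + 1) (-n) (by ring)).app Y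
    obtain ⟨k, hk⟩ := (CategoryTheory.shiftFunctor _ ((m : ℤ) + 1)).map_surjective
      (e₂.inv ≫ g ≫ i.hom)
    have hk₀ : k = 0 := by
      rw [← cancel_epi e₁.inv, comp_zero]
      exact H p _ (by lia) _
    have hg₀ : g = 0 := by
      rw [← cancel_epi e₂.inv, ← cancel_mono i.hom, Category.assoc, ← hk, hk₀]
      simp
    rw [hg, hg₀]
    exact comp_zero

lemma mem_extKer_Iclass_iff (I : Set P) (X : HomotopyCategory P (ComplexShape.up ℤ)) :
    X ∈ extKer (Iclass P I) ↔ ∀ J ∈ I, ∀ (k : ℕ)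
      (f : X ⟶ ((emb P).obj J)⟦((k + 1 : ℕ) : ℤ)⟧), f = 0 := by
  constructor
  · intro h J hJ k f
    exact h _ ⟨J, hJ, ⟨Iso.refl _⟩⟩ _ (by lia) f
  · rintro h I' ⟨J, hJ, ⟨e⟩⟩ m hm f
    obtain ⟨k, rfl⟩ : ∃ k : ℕ, ((k + 1 : ℕ) : ℤ) = m := ⟨(m - 1).toNat, by lia⟩
    rw [← cancel_mono ((CategoryTheory.shiftFunctor _ _).mapIso e).hom, zero_comp]
    exact h J hJ k _

lemma mem_extKer_of_iso {C : Type*} [Category C] [HasShift C ℤ] [Preadditive C]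
    {S : Set C} {X Y : C} (e : X ≅ Y) (hX : X ∈ extKer S) : Y ∈ extKer S := by
  intro I' hI' m hm f
  rw [← cancel_epi e.hom, comp_zero]
  exact hX I' hI' m hm _

end Vanishing

section Exactness

variable {P}

lemma quotient_mem_extKer_iff (d : ℕ) (I : Set P) (K : CochainComplex P ℤ)
    [K.IsStrictlyGE (-((d + 1 : ℕ) : ℤ))] :
    (HomotopyCategory.quotient P (ComplexShape.up ℤ)).obj K ∈ extKer (Iclass P I) ↔
      ∀ J ∈ I, finRightExact d (fun k ↦ K.X (-(k : ℤ)))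
        (fun k ↦ K.d (-((k + 1 : ℕ) : ℤ)) (-(k : ℤ))) J := by
  rw [mem_extKer_Iclass_iff]
  refine forall₂_congr fun J _ ↦ ?_
  have h (k : ℕ) := forall_hom_to_emb_shift_eq_zero_iff K J ((k + 1 : ℕ) : ℤ)
    (-((k + 1 : ℕ) : ℤ)) (-((k + 1 + 1 : ℕ) : ℤ)) (-(k : ℤ)) (by lia) (by lia) (by lia)
  constructor
  · intro H
    refine ⟨fun j _ ↦ (h j).1 (H j), fun g ↦ (h d).1 (H d) g ?_⟩
    exact (K.isZero_of_isStrictlyGE (-((d + 1 : ℕ) : ℤ)) _ (by lia)).eq_of_src _ _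
  · intro H k
    refine (h k).2 fun g hg ↦ ?_
    obtain hk | rfl | hk := lt_trichotomy k d
    · exact H.1 k hk g hg
    · exact H.2 g
    · exact ⟨0, (K.isZero_of_isStrictlyGE (-((d + 1 : ℕ) : ℤ)) _ (by lia)).eq_of_src _ _⟩

lemma forall_hom_emb_shift_neg_eq_zero_iff (d : ℕ) (Q : P) (K : CochainComplex P ℤ)
    [K.IsStrictlyGE (-((d + 1 : ℕ) : ℤ))] :
    (∀ n : ℤ, 1 ≤ n → ∀ f : (emb P).obj Q ⟶
      ((HomotopyCategory.quotient P (ComplexShape.up ℤ)).obj K)⟦-n⟧, f = 0) ↔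
      finLeftExact d (fun k ↦ K.X (-(k : ℤ)))
        (fun k ↦ K.d (-((k + 1 : ℕ) : ℤ)) (-(k : ℤ))) Q := by
  have h (k : ℕ) := forall_hom_emb_shift_eq_zero_iff K Q
    (-((k + 1 : ℕ) : ℤ)) (-((k + 1 + 1 : ℕ) : ℤ)) (-(k : ℤ)) (by lia) (by lia)
  constructor
  · intro H
    refine ⟨fun g g' hg ↦ ?_, fun j _ ↦ (h j).1 (H _ (by lia))⟩
    obtain ⟨x, hx⟩ := (h d).1 (H _ (by lia)) (g - g') (by
      rw [Preadditive.sub_comp, sub_eq_zero]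
      exact hg)
    rw [← sub_eq_zero, ← hx,
      (K.isZero_of_isStrictlyGE (-((d + 1 : ℕ) : ℤ)) (-((d + 1 + 1 : ℕ) : ℤ))
        (by lia)).eq_of_tgt x 0, zero_comp]
  · intro H n hn
    obtain ⟨k, rfl⟩ : ∃ k : ℕ, ((k + 1 : ℕ) : ℤ) = n := ⟨(n - 1).toNat, by lia⟩
    refine (h k).2 fun g hg ↦ ?_
    obtain hk | rfl | hk := lt_trichotomy k d
    · exact H.2 k hk g hg
    · exact ⟨0, by rw [zero_comp]; exact H.1 0 g (by rw [zero_comp]; exact hg.symm)⟩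
    · exact ⟨0, (K.isZero_of_isStrictlyGE (-((d + 1 : ℕ) : ℤ)) _ (by lia)).eq_of_tgt _ _⟩

lemma finRightExact_of_iso {d : ℕ} {N N' : ℕ → P} {φ : ∀ k, N (k + 1) ⟶ N k}
    {φ' : ∀ k, N' (k + 1) ⟶ N' k} (e : ∀ k, k ≤ d + 1 → (N k ≅ N' k))
    (he : ∀ (k : ℕ) (hk : k ≤ d),
      φ k ≫ (e k (by lia)).hom = (e (k + 1) (by lia)).hom ≫ φ' k) {J : P}
    (H : finRightExact d N φ J) : finRightExact d N' φ' J := by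
  refine ⟨fun j hj g hg ↦ ?_, fun g ↦ ?_⟩
  · obtain ⟨h, hh⟩ := H.1 j hj ((e (j + 1) (by lia)).hom ≫ g) (by
      rw [← Category.assoc, he (j + 1) (by lia), Category.assoc, hg, comp_zero])
    refine ⟨(e j (by lia)).inv ≫ h, ?_⟩
    rw [← cancel_epi (e (j + 1) (by lia)).hom, ← hh, ← Category.assoc, ← he j (by lia)]
    simp
  · obtain ⟨h, hh⟩ := H.2 ((e (d + 1) (by lia)).hom ≫ g)
    refine ⟨(e d (by lia)).inv ≫ h, ?_⟩
    rw [← cancel_epi (e (d + 1) (by lia)).hom, ← hh, ← Category.assoc, ← he d (by lia)]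
    simp

lemma finLeftExact_of_iso {d : ℕ} {N N' : ℕ → P} {φ : ∀ k, N (k + 1) ⟶ N k}
    {φ' : ∀ k, N' (k + 1) ⟶ N' k} (e : ∀ k, k ≤ d + 1 → (N k ≅ N' k))
    (he : ∀ (k : ℕ) (hk : k ≤ d),
      φ k ≫ (e k (by lia)).hom = (e (k + 1) (by lia)).hom ≫ φ' k) {Q : P}
    (H : finLeftExact d N' φ' Q) : finLeftExact d N φ Q := by
  refine ⟨fun g g' hg ↦ ?_, fun j hj g hg ↦ ?_⟩
  · rw [← cancel_mono (e (d + 1) (by lia)).hom]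
    refine H.1 _ _ ?_
    simp only [Category.assoc, ← he d le_rfl, reassoc_of% hg]
  · obtain ⟨h, hh⟩ := H.2 j hj (g ≫ (e (j + 1) (by lia)).hom) (by
      rw [Category.assoc, ← he j (by lia), ← Category.assoc, hg, zero_comp])
    refine ⟨h ≫ (e (j + 2) (by lia)).inv, ?_⟩
    rw [← cancel_mono (e (j + 1) (by lia)).hom, ← hh, Category.assoc, Category.assoc,
      he (j + 1) (by lia)]
    simp

lemma exists_cochainComplex (d : ℕ) (N : ℕ → P) (φ : ∀ k, N (k + 1) ⟶ N k)
    (hφ : ∀ k, k < d → φ (k + 1) ≫ φ k = 0) :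
    ∃ (K : CochainComplex P ℤ) (_ : K.IsStrictlyGE (-((d + 1 : ℕ) : ℤ)))
      (_ : K.IsStrictlyLE 0) (e : ∀ k : ℕ, k ≤ d + 1 → (N k ≅ K.X (-(k : ℤ)))),
      ∀ (k : ℕ) (hk : k ≤ d), φ k ≫ (e k (by lia)).hom =
        (e (k + 1) (by lia)).hom ≫ K.d (-((k + 1 : ℕ) : ℤ)) (-(k : ℤ)) := by
  let φ' (k : ℕ) : N (k + 1) ⟶ N k := if k ≤ d then φ k else 0
  let C : ChainComplex P ℕ := ChainComplex.of N φ' (fun k ↦ by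
    by_cases hk : k < d
    · simp [φ', hk, hk.le, hφ k hk]
    · simp [φ', show ¬ k + 1 ≤ d by lia])
  let K₀ : CochainComplex P ℤ := C.extend ComplexShape.embeddingDownNat
  let e₀ (k : ℕ) : K₀.X (-(k : ℤ)) ≅ N k :=
    C.extendXIso ComplexShape.embeddingDownNat rfl
  have he₀ (k : ℕ) : K₀.d (-((k + 1 : ℕ) : ℤ)) (-(k : ℤ)) =
      (e₀ (k + 1)).hom ≫ φ' k ≫ (e₀ k).inv := by
    rw [← ChainComplex.of_d N φ' k]
    exact C.extend_d_eq ComplexShape.embeddingDownNat rfl rfl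
  have : K₀.IsStrictlyLE 0 := by
    rw [CochainComplex.isStrictlyLE_iff]
    intro i hi
    exact C.isZero_extend_X _ _ (fun k (hk : -(k : ℤ) = i) ↦ by lia)
  refine ⟨K₀.stupidTrunc (ComplexShape.embeddingUpIntGE (-((d + 1 : ℕ) : ℤ))),
    inferInstance, inferInstance,
    fun k hk ↦ (e₀ k).symm ≪≫ (stupidTruncGEXIso K₀ _ _ (by lia)).symm, fun k hk ↦ ?_⟩
  rw [stupidTruncGE_d K₀ _ _ _ (by lia) (by lia), he₀]
  simp [φ', hk]

lemma emb_mem_V_inter_extKer (I : Set P) (p : P) (m : ℕ) :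
    (emb P).obj p ∈ V (Pclass P) m ∩ extKer (Iclass P I) := by
  let S := (CochainComplex.singleFunctor P 0).obj p
  have hS (i : ℤ) (hi : i ≠ 0) : IsZero (S.X i) :=
    HomologicalComplex.isZero_single_obj_X _ _ _ _ hi
  have : S.IsStrictlyGE (-(m : ℤ)) := by
    rw [CochainComplex.isStrictlyGE_iff]
    exact fun i hi ↦ hS i (by lia)
  refine ⟨quotient_mem_V m S, (mem_extKer_Iclass_iff I _).2 fun J _ k ↦ ?_⟩
  refine (forall_hom_to_emb_shift_eq_zero_iff S J _ (-((k + 1 : ℕ) : ℤ)) _ _ (by lia)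
    (sub_add_cancel _ 1) rfl).2 fun g _ ↦ ?_
  exact ⟨0, (hS _ (by lia)).eq_of_src _ _⟩

lemma emb_map_bijective (p p' : P) :
    Function.Bijective (fun f : p ⟶ p' ↦ (emb P).map f) := by
  let ι := HomologicalComplex.single P (ComplexShape.up ℤ) 0
  let q := HomotopyCategory.quotient P (ComplexShape.up ℤ)
  constructor
  · intro f g (h : q.map (ι.map f) = q.map (ι.map g))
    have hc := (HomotopyCategory.homotopyOfEq _ _ h).comm 0
    refine ι.map_injective (HomologicalComplex.from_single_hom_ext ?_)
    simpa [ι, dNext, prevD] using hc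
  · intro f
    obtain ⟨f', rfl⟩ := q.map_surjective f
    obtain ⟨f'', rfl⟩ := ι.map_surjective f'
    exact ⟨f'', rfl⟩

end Exactness

theorem statement8 (d : ℕ) (hd : 1 ≤ d) (I : Set P)
    (hIiso : ∀ ⦃X Y : P⦄, (X ≅ Y) → X ∈ I → Y ∈ I)
    (hIsum : ∀ ⦃X Y : P⦄, X ∈ I → Y ∈ I → (X ⊞ Y) ∈ I)
    (hIzero : ∀ ⦃X : P⦄, IsZero X → X ∈ I)
    (hcov : CovFin (Iclass P I) (V (Pclass P) d ∩ extKer (Iclass P I))) :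
    (∀ X ∈ V (Pclass P) (d + 1) ∩ extKer (Iclass P I),
      ∀ Y ∈ V (Pclass P) (d + 1) ∩ extKer (Iclass P I),
        ∀ n : ℤ, 1 ≤ n → ∀ f : X ⟶ Y⟦-n⟧, f = 0) ↔
      ((∀ p : P, ∃ Iobj ∈ I, ∃ f : p ⟶ Iobj,
          ∀ (Q : P) (g g' : Q ⟶ p), g ≫ f = g' ≫ f → g = g') ∧
        ∀ (N : ℕ → P) (φ : ∀ k, N (k + 1) ⟶ N k),
          (∀ k, k < d → φ (k + 1) ≫ φ k = 0) →
          (∀ Iobj ∈ I, finRightExact d N φ Iobj) →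
          ∀ Q : P, finLeftExact d N φ Q) := by
  constructor
  · intro H
    have H3 : ∀ (N : ℕ → P) (φ : ∀ k, N (k + 1) ⟶ N k),
        (∀ k, k < d → φ (k + 1) ≫ φ k = 0) →
        (∀ Iobj ∈ I, finRightExact d N φ Iobj) → ∀ Q : P, finLeftExact d N φ Q := by
      intro N φ hφ hR Q
      obtain ⟨K, _, _, e, he⟩ := exists_cochainComplex d N φ hφ
      refine finLeftExact_of_iso e he ((forall_hom_emb_shift_neg_eq_zero_iff d Q K).1 ?_)
      exact H _ (emb_mem_V_inter_extKer I Q _) _ ⟨quotient_mem_V _ K,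
        (quotient_mem_extKer_iff d I K).2 fun J hJ ↦ finRightExact_of_iso e he (hR J hJ)⟩
    refine ⟨fun p ↦ ?_, H3⟩
    obtain ⟨J₀, f₀, hJ₀, hf₀⟩ : ∃ (J₀ : P) (f₀ : p ⟶ J₀), J₀ ∈ I ∧
        ∀ J ∈ I, ∀ g : p ⟶ J, ∃ h : J₀ ⟶ J, f₀ ≫ h = g := by
      obtain ⟨A, ⟨J₀, hJ₀, ⟨e⟩⟩, f, hf⟩ := hcov _ (emb_mem_V_inter_extKer I p d)
      obtain ⟨f₀, h₀⟩ := (emb_map_bijective p J₀).2 (f ≫ e.hom)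
      refine ⟨J₀, f₀, hJ₀, fun J hJ g ↦ ?_⟩
      obtain ⟨h, hh⟩ := hf _ ⟨J, hJ, ⟨Iso.refl _⟩⟩ ((emb P).map g)
      obtain ⟨k, hk⟩ := (emb_map_bijective J₀ J).2 (e.inv ≫ h)
      refine ⟨k, (emb_map_bijective p J).1 ?_⟩
      dsimp only at h₀ hk ⊢
      rw [Functor.map_comp, h₀, hk, ← hh]
      simp
    obtain ⟨Z, hZ⟩ := HasZeroObject.zero (C := P)
    let N : ℕ → P
      | 0 => J₀
      | 1 => p
      | _ + 2 => Z
    let φ : ∀ k, N (k + 1) ⟶ N k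
      | 0 => f₀
      | _ + 1 => 0
    have hN (k : ℕ) (hk : 2 ≤ k) : IsZero (N k) := by
      obtain ⟨k, rfl⟩ := Nat.exists_eq_add_of_le' hk
      exact hZ
    refine ⟨J₀, hJ₀, f₀, fun Q g g' hg ↦ ?_⟩
    have hex := H3 N φ (fun k _ ↦ zero_comp) (fun J hJ ↦ ⟨fun j _ g _ ↦ ?_, fun g ↦
      ⟨0, (hN (d + 1) (by lia)).eq_of_src _ _⟩⟩) Q
    · obtain ⟨h, hh⟩ := hex.2 0 (by lia) (g - g') (by
        rw [Preadditive.sub_comp, sub_eq_zero]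
        exact hg)
      rw [← sub_eq_zero, ← hh]
      exact comp_zero
    · obtain _ | j := j
      · exact hf₀ J hJ g
      · exact ⟨0, (hN (j + 2) (by lia)).eq_of_src _ _⟩
  · rintro ⟨-, H3⟩ X ⟨hX, -⟩ Y ⟨hY, hY'⟩ n hn f
    obtain ⟨K, _, _, ⟨e⟩⟩ := exists_iso_quotient_of_mem_V (d + 1) Y hY
    refine hom_shift_neg_eq_zero_of_mem_V Y (fun Q n hn f ↦ ?_) (d + 1) X hX n hn f
    rw [← cancel_mono ((CategoryTheory.shiftFunctor _ (-n)).mapIso e).hom, zero_comp]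
    refine (forall_hom_emb_shift_neg_eq_zero_iff d Q K).2 ?_ n hn _
    refine H3 _ _ (fun k _ ↦ K.d_comp_d _ _ _) ?_ Q
    exact (quotient_mem_extKer_iff d I K).1 (mem_extKer_of_iso e hY')

end AuslanderIyamaStmt8
end

section
/- Fix d ≥ 1. Let E be an abelian category with enough injectives and M ⊆ E a d-cluster-tilting subcategory. Then: (a) every injective object of E belongs to M; and (b) for every complex 0 → M_{d+1} → M_d → ⋯ → M_1 → M_0 with all M_i ∈ M such that the induced sequence Hom_E(M_0, I) → Hom_E(M_1, I) → ⋯ → Hom_E(M_{d+1}, I) → 0 is exact for every injective object I of E, the complex 0 → M_{d+1} → M_d → ⋯ → M_1 → M_0 is an exact sequence in E, and moreover for every M' ∈ M the induced sequence 0 → Hom_E(M', M_{d+1}) → Hom_E(M', M_d) → ⋯ → Hom_E(M', M_1) → Hom_E(M', M_0) is exact. -/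
/-!
Statement 11: Let `E` be an abelian category with enough injectives and `M` a
`d`-cluster-tilting subcategory. Then (a) every injective object of `E` belongs to `M`;
and (b) every complex `0 → M_{d+1} → ⋯ → M_1 → M_0` with terms in `M` whose
`Hom(-, I)`-sequence is exact for every injective `I` is exact in `E`, and its
`Hom(M', -)`-sequence `0 → Hom(M', M_{d+1}) → ⋯ → Hom(M', M_0)` is exact for every
`M' ∈ M`.
-/

open CategoryTheory Limits Abelian

universe w v u

namespace AuslanderIyamaStmt11

section

variable {E : Type u} [Category.{v} E]

/-- If every morphism from `X` to an injective object factors through `f : X ⟶ Y`, then `f` is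
a monomorphism. -/
lemma mono_of_forall_injective_factors [EnoughInjectives E] {X Y : E} (f : X ⟶ Y)
    (H : ∀ I : E, Injective I → ∀ u : X ⟶ I, ∃ h : Y ⟶ I, f ≫ h = u) : Mono f :=
  mono_of_mono_fac (H _ inferInstance (Injective.ι X)).choose_spec

variable [Abelian E]

/-- If every morphism from `Y` to an injective object which is killed by `f : X ⟶ Y` factors
through `g : Y ⟶ Z`, then `X ⟶ Y ⟶ Z` is exact. -/
lemma exact_of_forall_injective_factors [EnoughInjectives E] {X Y Z : E} (f : X ⟶ Y) (g : Y ⟶ Z)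
    (w : f ≫ g = 0)
    (H : ∀ I : E, Injective I → ∀ u : Y ⟶ I, f ≫ u = 0 → ∃ h : Z ⟶ I, g ≫ h = u) :
    (ShortComplex.mk f g w).Exact := by
  rw [ShortComplex.exact_iff_mono_cokernel_desc]
  obtain ⟨h, hh⟩ := H _ inferInstance (cokernel.π f ≫ Injective.ι (cokernel f)) (by simp)
  have fac : cokernel.desc f g w ≫ h = Injective.ι (cokernel f) := by
    rw [← cancel_epi (cokernel.π f), cokernel.π_desc_assoc, hh]
  exact mono_of_mono_fac fac

/-- An exact sequence `X ⟶ Y ⟶ Z` gives a short exact sequence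
`0 ⟶ kernel f ⟶ X ⟶ kernel g ⟶ 0`. -/
lemma shortExact_kernels {X Y Z : E} {f : X ⟶ Y} {g : Y ⟶ Z} {w : f ≫ g = 0}
    (hfg : (ShortComplex.mk f g w).Exact) :
    (ShortComplex.mk (kernel.ι f) (kernel.lift g f w)
      (by rw [← cancel_mono (kernel.ι g)]; simp)).ShortExact where
  exact := by
    refine ShortComplex.exact_of_f_is_kernel _ (KernelFork.IsLimit.ofι' _ _ fun {A} k hk ↦ ?_)
    have hk' : k ≫ f = 0 := by
      have := hk =≫ kernel.ι g
      simpa using this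
    exact ⟨kernel.lift f k hk', by simp⟩
  mono_f := by dsimp; infer_instance
  epi_g := (ShortComplex.exact_iff_epi_kernel_lift _).1 hfg

end

variable {E : Type u} [Category.{v} E] [Abelian E] [HasExt.{w} E]

lemma subsingleton_ext_X₃ {S : ShortComplex E} (hS : S.ShortExact) (X : E) (n : ℕ)
    (h₂ : Subsingleton (Ext X S.X₂ n)) (h₁ : Subsingleton (Ext X S.X₁ (n + 1))) :
    Subsingleton (Ext X S.X₃ n) :=
  subsingleton_of_forall_eq 0 fun x ↦ by
    obtain ⟨y, rfl⟩ := Ext.covariant_sequence_exact₃ X hS x rfl (Subsingleton.elim _ _)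
    rw [Subsingleton.elim y 0, Ext.zero_comp]

lemma exists_lift_of_subsingleton_ext_one {S : ShortComplex E} (hS : S.ShortExact) {X : E}
    (h₁ : Subsingleton (Ext X S.X₁ 1)) (u : X ⟶ S.X₃) : ∃ v : X ⟶ S.X₂, v ≫ S.g = u := by
  obtain ⟨y, hy⟩ := Ext.covariant_sequence_exact₃ X hS (Ext.mk₀ u) (zero_add 1)
    (Subsingleton.elim _ _)
  obtain ⟨v, rfl⟩ := (Ext.mk₀_bijective X S.X₂).2 y
  rw [Ext.mk₀_comp_mk₀] at hy
  exact ⟨v, (Ext.mk₀_bijective X S.X₃).1 hy⟩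

/-- Dimension shifting along an exact sequence `0 ⟶ N (d + 1) ⟶ ⋯ ⟶ N 0`: if the `Ext`-groups
from `X` to its terms vanish in degrees `1, …, d - 1`, then those to the kernel of
`N (j + 1) ⟶ N j` vanish in degrees `1, …, j`. -/
lemma subsingleton_ext_kernel {d : ℕ} {N : ℕ → E} {φ : ∀ k, N (k + 1) ⟶ N k}
    {hcx : ∀ k, k < d → φ (k + 1) ≫ φ k = 0} (hmono : Mono (φ d))
    (hexact : ∀ j (hj : j < d), (ShortComplex.mk (φ (j + 1)) (φ j) (hcx j hj)).Exact) {X : E}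
    (hX : ∀ k ≤ d + 1, ∀ i, 1 ≤ i → i ≤ d - 1 → Subsingleton (Ext X (N k) i))
    {j : ℕ} (hj : j ≤ d) : ∀ i, 1 ≤ i → i ≤ j → Subsingleton (Ext X (kernel (φ j)) i) := by
  induction hj using Nat.decreasingInduction with
  | self =>
    intro i hi _
    have : Injective (kernel (φ d)) :=
      Injective.of_iso (isZero_kernel_of_mono (φ d)).isoZero.symm inferInstance
    obtain ⟨i, rfl⟩ := Nat.exists_eq_add_of_le' hi
    exact Ext.subsingleton_of_injective _ _ _
  | of_succ j hj ih =>
    intro i hi hij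
    exact subsingleton_ext_X₃ (shortExact_kernels (hexact j hj)) X i
      (hX (j + 2) (by omega) i hi (by omega)) (ih (i + 1) (by omega) (by omega))

theorem statement11 (d : ℕ) (hd : 1 ≤ d) [EnoughInjectives E] (M : Set E)
    (hMiso : ∀ ⦃X Y : E⦄, (X ≅ Y) → X ∈ M → Y ∈ M)
    (hMsum : ∀ ⦃X Y : E⦄, X ∈ M → Y ∈ M → (X ⊞ Y) ∈ M)
    (hMzero : ∀ ⦃X : E⦄, IsZero X → X ∈ M)
    (hMsummand : ∀ ⦃X Y Z : E⦄, X ∈ M → Nonempty (X ≅ Y ⊞ Z) → Y ∈ M)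
    -- (i): every object admits a left `M`-approximation which is a monomorphism
    (happrox₁ : ∀ X : E, ∃ M₀ ∈ M, ∃ f : X ⟶ M₀, Mono f ∧
      ∀ M' ∈ M, ∀ g : X ⟶ M', ∃ h : M₀ ⟶ M', f ≫ h = g)
    -- (ii): every object admits a right `M`-approximation which is an epimorphism
    (happrox₂ : ∀ X : E, ∃ M₀ ∈ M, ∃ g : M₀ ⟶ X, Epi g ∧
      ∀ M' ∈ M, ∀ u : M' ⟶ X, ∃ h : M' ⟶ M₀, h ≫ g = u)
    -- (iii): `M` equals both `Ext`-orthogonals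
    (hortho₁ : ∀ X : E,
      (X ∈ M ↔ ∀ M' ∈ M, ∀ i : ℕ, 1 ≤ i → i ≤ d - 1 → Subsingleton (Ext M' X i)))
    (hortho₂ : ∀ X : E,
      (X ∈ M ↔ ∀ M' ∈ M, ∀ i : ℕ, 1 ≤ i → i ≤ d - 1 → Subsingleton (Ext X M' i))) :
    -- (a): every injective object belongs to `M`
    (∀ I : E, Injective I → I ∈ M) ∧
    -- (b): complexes over `M` with exact `Hom(-, I)`-sequences are exact
    ∀ (N : ℕ → E) (φ : ∀ k, N (k + 1) ⟶ N k),
      (∀ k ≤ d + 1, N k ∈ M) →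
      ∀ (hcx : ∀ k, k < d → φ (k + 1) ≫ φ k = 0),
      -- exactness of `Hom(N 0, I) → Hom(N 1, I) → ⋯ → Hom(N (d+1), I) → 0`
      -- for every injective `I`
      (∀ I : E, Injective I →
        (∀ j, j < d → ∀ g : N (j + 1) ⟶ I, φ (j + 1) ≫ g = 0 →
          ∃ h : N j ⟶ I, φ j ≫ h = g) ∧
        ∀ g : N (d + 1) ⟶ I, ∃ h : N d ⟶ I, φ d ≫ h = g) →
      -- the complex `0 → N (d+1) → ⋯ → N 1 → N 0` is exact in `E` …
      ((Mono (φ d) ∧ ∀ j (hj : j < d),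
          (ShortComplex.mk (φ (j + 1)) (φ j) (hcx j hj)).Exact) ∧
        -- … and `0 → Hom(M', N (d+1)) → ⋯ → Hom(M', N 1) → Hom(M', N 0)` is exact
        ∀ M' ∈ M,
          (∀ g g' : M' ⟶ N (d + 1), g ≫ φ d = g' ≫ φ d → g = g') ∧
          ∀ j, j < d → ∀ g : M' ⟶ N (j + 1), g ≫ φ j = 0 →
            ∃ h : M' ⟶ N (j + 2), h ≫ φ (j + 1) = g) := by
  refine ⟨fun I hI ↦ (hortho₁ I).2 fun M' _ i hi _ ↦ ?_, fun N φ hN hcx hinj ↦ ?_⟩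
  · obtain ⟨i, rfl⟩ := Nat.exists_eq_add_of_le' hi
    exact Ext.subsingleton_of_injective _ _ _
  have hmono : Mono (φ d) := mono_of_forall_injective_factors _ fun I hI ↦ (hinj I hI).2
  have hexact : ∀ j (hj : j < d), (ShortComplex.mk (φ (j + 1)) (φ j) (hcx j hj)).Exact :=
    fun j hj ↦ exact_of_forall_injective_factors _ _ _ fun I hI ↦ (hinj I hI).1 j hj
  refine ⟨⟨hmono, hexact⟩, fun M' hM' ↦ ⟨fun g g' h ↦ (cancel_mono (φ d)).1 h,
    fun j hj g hg ↦ ?_⟩⟩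
  have hExt := subsingleton_ext_kernel hmono hexact
    (fun k hk ↦ (hortho₁ (N k)).1 (hN k hk) M' hM') hj 1 le_rfl (by omega)
  obtain ⟨h, hh⟩ := exists_lift_of_subsingleton_ext_one (shortExact_kernels (hexact j hj)) hExt
    (kernel.lift (φ j) g hg)
  refine ⟨h, ?_⟩
  have := hh =≫ kernel.ι (φ j)
  simpa using this

end AuslanderIyamaStmt11
end

section
/- Fix d ≥ 1. Let E be an abelian category with enough injectives and M ⊆ E a d-cluster-tilting subcategory. Then every morphism f : M₁ → M₀ between objects of M fits into a complex 0 → M_{d+1} → M_d → ⋯ → M_2 → M_1 → M_0 with all M_i ∈ M, whose last map is f, which is exact at M_{d+1}, M_d, …, M_1 (i.e. 0 → M_{d+1} → ⋯ → M_2 → ker f → 0 is exact), and such that for every M' ∈ M the sequence 0 → Hom_E(M', M_{d+1}) → ⋯ → Hom_E(M', M_2) → Hom_E(M', M_1) obtained by applying Hom_E(M', −) remains exact at the corresponding positions. -/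
/-!
Statement 12: Let `E` be an abelian category with enough injectives and `M` a
`d`-cluster-tilting subcategory. Then every morphism `f : M₁ ⟶ M₀` in `M` fits into a
complex `0 → M_{d+1} → ⋯ → M_2 → M_1 → M_0` with all terms in `M`, whose last map is
`f`, which is exact at `M_{d+1}, …, M_1`, and which becomes exact at the corresponding
positions after applying `Hom(M', -)` for every `M' ∈ M`.
-/

open CategoryTheory Limits Abelian

universe w v u

namespace AuslanderIyamaStmt12

variable {E : Type u} [Category.{v} E] [Abelian E] [HasExt.{w} E]

/-- A chosen epimorphic right `M`-approximation of an object, which is an isomorphism for objects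
of `M`. -/
structure RightApprox (M : Set E) (X : E) where
  /-- The source of the approximation. -/
  obj : E
  /-- The approximation. -/
  hom : obj ⟶ X
  mem : obj ∈ M
  epi : Epi hom
  lift : ∀ M' ∈ M, ∀ u : M' ⟶ X, ∃ h : M' ⟶ obj, h ≫ hom = u
  isIso : X ∈ M → IsIso hom

omit [Abelian E] [HasExt.{w} E] in
lemma nonempty_rightApprox {M : Set E} {X : E}
    (h : ∃ M₀ ∈ M, ∃ g : M₀ ⟶ X, Epi g ∧ ∀ M' ∈ M, ∀ u : M' ⟶ X, ∃ h : M' ⟶ M₀, h ≫ g = u) :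
    Nonempty (RightApprox M X) := by
  by_cases hX : X ∈ M
  · exact ⟨⟨X, 𝟙 X, hX, inferInstance, fun _ _ u => ⟨u, Category.comp_id u⟩,
      fun _ => inferInstance⟩⟩
  · obtain ⟨M₀, hM₀, g, hg, hlift⟩ := h
    exact ⟨⟨M₀, g, hM₀, hg, hlift, fun hX' => (hX hX').elim⟩⟩

/-- The iterated right approximations of kernels, starting from a morphism `f`: the `k`-th term
is the `k`-th differential of the resulting complex. -/
noncomputable def approxSeq {M : Set E} (A : ∀ X : E, RightApprox M X) (f : Arrow E) : ℕ → Arrow E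
  | 0 => f
  | k + 1 => Arrow.mk ((A (kernel (approxSeq A f k).hom)).hom ≫ kernel.ι (approxSeq A f k).hom)

omit [HasExt.{w} E] in
lemma shortExact_kernel_comp_kernel_ι {A B P : E} (f : A ⟶ B) (p : P ⟶ kernel f) [Epi p] :
    (ShortComplex.mk (kernel.ι (p ≫ kernel.ι f)) p
      (by simp [← cancel_mono (kernel.ι f)])).ShortExact where
  exact := by
    refine ShortComplex.exact_of_f_is_kernel _ (KernelFork.IsLimit.ofι' _ _ fun k hk => ?_)
    exact ⟨kernel.lift _ k (by rw [← Category.assoc, hk, zero_comp]), by simp⟩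
  mono_f := inferInstanceAs (Mono (kernel.ι _))
  epi_g := ‹_›

omit [HasExt.{w} E] in
lemma comp_kernel_ι_comp {A B P : E} (f : A ⟶ B) (p : P ⟶ kernel f) :
    (p ≫ kernel.ι f) ≫ f = 0 := by
  simp

omit [HasExt.{w} E] in
lemma exists_comp_kernel_ι_eq {A B P Y : E} (f : A ⟶ B) (p : P ⟶ kernel f)
    (hp : ∀ u : Y ⟶ kernel f, ∃ h : Y ⟶ P, h ≫ p = u) (g : Y ⟶ A) (hg : g ≫ f = 0) :
    ∃ h : Y ⟶ P, h ≫ p ≫ kernel.ι f = g := by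
  obtain ⟨h, hh⟩ := hp (kernel.lift f g hg)
  exact ⟨h, by rw [← Category.assoc, hh, kernel.lift_ι]⟩

omit [HasExt.{w} E] in
lemma exact_comp_kernel_ι {A B P : E} (f : A ⟶ B) (p : P ⟶ kernel f) [Epi p] :
    (ShortComplex.mk (p ≫ kernel.ι f) f (comp_kernel_ι_comp f p)).Exact := by
  rw [ShortComplex.exact_iff_epi_kernel_lift]
  have h : kernel.lift f (p ≫ kernel.ι f) (comp_kernel_ι_comp f p) = p := by simp [← cancel_mono (kernel.ι f)]
  dsimp only
  rw [h]
  infer_instance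

lemma subsingleton_ext_one_of_lift {S : ShortComplex E} (hS : S.ShortExact) (Y : E)
    (h₂ : Subsingleton (Ext Y S.X₂ 1)) (hlift : ∀ u : Y ⟶ S.X₃, ∃ h : Y ⟶ S.X₂, h ≫ S.g = u) :
    Subsingleton (Ext Y S.X₁ 1) := by
  refine subsingleton_of_forall_eq 0 fun x => ?_
  obtain ⟨x₃, rfl⟩ := Ext.covariant_sequence_exact₁ Y hS x (Subsingleton.elim _ _) (zero_add 1)
  obtain ⟨u, rfl⟩ := Ext.addEquiv₀.symm.surjective x₃
  obtain ⟨h, rfl⟩ := hlift u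
  change (Ext.mk₀ (h ≫ S.g)).comp hS.extClass (zero_add 1) = 0
  rw [← Ext.mk₀_comp_mk₀_assoc, hS.comp_extClass, Ext.comp_zero]

lemma subsingleton_ext_succ {S : ShortComplex E} (hS : S.ShortExact) (Y : E) (n : ℕ)
    (h₂ : Subsingleton (Ext Y S.X₂ (n + 1))) (h₃ : Subsingleton (Ext Y S.X₃ n)) :
    Subsingleton (Ext Y S.X₁ (n + 1)) := by
  refine subsingleton_of_forall_eq 0 fun x => ?_
  obtain ⟨x₃, rfl⟩ := Ext.covariant_sequence_exact₁ Y hS x (Subsingleton.elim _ _) rfl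
  rw [Subsingleton.elim x₃ 0, Ext.zero_comp]

/-- The `k`-th iterated kernel is `Ext`-orthogonal to `M` in degrees `1, …, k`, up to the bound `n`
below which `M` itself is `Ext`-orthogonal to `M`. -/
lemma subsingleton_ext_kernel_approxSeq {M : Set E} (A : ∀ X : E, RightApprox M X) (f : Arrow E)
    {n : ℕ} (hM : ∀ X ∈ M, ∀ Y ∈ M, ∀ i : ℕ, 1 ≤ i → i ≤ n → Subsingleton (Ext Y X i))
    (k : ℕ) {Y : E} (hY : Y ∈ M) (i : ℕ) (hi : 1 ≤ i) (hik : i ≤ k) (hin : i ≤ n) :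
    Subsingleton (Ext Y (kernel (approxSeq A f k).hom) i) := by
  induction k generalizing i with
  | zero => omega
  | succ k ih =>
    have := (A (kernel (approxSeq A f k).hom)).epi
    have hS := shortExact_kernel_comp_kernel_ι (approxSeq A f k).hom
      (A (kernel (approxSeq A f k).hom)).hom
    have h₂ := hM _ (A (kernel (approxSeq A f k).hom)).mem Y hY i hi hin
    obtain rfl | ⟨i, rfl, hi'⟩ : i = 1 ∨ ∃ j, i = j + 1 ∧ 1 ≤ j := by
      obtain rfl | h := hi.eq_or_lt
      · exact Or.inl rfl
      · exact Or.inr ⟨i - 1, by omega, by omega⟩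
    · exact subsingleton_ext_one_of_lift hS Y h₂
        ((A (kernel (approxSeq A f k).hom)).lift Y hY)
    · exact subsingleton_ext_succ hS Y i h₂ (ih i hi' (by omega) (by omega))

theorem statement12 (d : ℕ) (hd : 1 ≤ d) [EnoughInjectives E] (M : Set E)
    (hMiso : ∀ ⦃X Y : E⦄, (X ≅ Y) → X ∈ M → Y ∈ M)
    (hMsum : ∀ ⦃X Y : E⦄, X ∈ M → Y ∈ M → (X ⊞ Y) ∈ M)
    (hMzero : ∀ ⦃X : E⦄, IsZero X → X ∈ M)
    (hMsummand : ∀ ⦃X Y Z : E⦄, X ∈ M → Nonempty (X ≅ Y ⊞ Z) → Y ∈ M)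
    -- (i): every object admits a left `M`-approximation which is a monomorphism
    (happrox₁ : ∀ X : E, ∃ M₀ ∈ M, ∃ f : X ⟶ M₀, Mono f ∧
      ∀ M' ∈ M, ∀ g : X ⟶ M', ∃ h : M₀ ⟶ M', f ≫ h = g)
    -- (ii): every object admits a right `M`-approximation which is an epimorphism
    (happrox₂ : ∀ X : E, ∃ M₀ ∈ M, ∃ g : M₀ ⟶ X, Epi g ∧
      ∀ M' ∈ M, ∀ u : M' ⟶ X, ∃ h : M' ⟶ M₀, h ≫ g = u)
    -- (iii): `M` equals both `Ext`-orthogonals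
    (hortho₁ : ∀ X : E,
      (X ∈ M ↔ ∀ M' ∈ M, ∀ i : ℕ, 1 ≤ i → i ≤ d - 1 → Subsingleton (Ext M' X i)))
    (hortho₂ : ∀ X : E,
      (X ∈ M ↔ ∀ M' ∈ M, ∀ i : ℕ, 1 ≤ i → i ≤ d - 1 → Subsingleton (Ext X M' i)))
    {M₁ M₀ : E} (hM₁ : M₁ ∈ M) (hM₀ : M₀ ∈ M) (f : M₁ ⟶ M₀) :
    -- the complex is `N (d+1) → ⋯ → N 1 → N 0` with `N 0 ≅ M₀`, `N 1 ≅ M₁`,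
    -- last map (the map `φ 0`) given by `f`
    ∃ (N : ℕ → E) (φ : ∀ k, N (k + 1) ⟶ N k) (e₀ : N 0 ≅ M₀) (e₁ : N 1 ≅ M₁),
      φ 0 = e₁.hom ≫ f ≫ e₀.inv ∧
      (∀ k ≤ d + 1, N k ∈ M) ∧
      ∃ hcx : ∀ k, k < d → φ (k + 1) ≫ φ k = 0,
        -- exactness at `M_{d+1}, …, M_1`
        Mono (φ d) ∧
        (∀ j (hj : j < d), (ShortComplex.mk (φ (j + 1)) (φ j) (hcx j hj)).Exact) ∧
        -- exactness of `0 → Hom(M', M_{d+1}) → ⋯ → Hom(M', M_2) → Hom(M', M_1)`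
        -- at the positions `M_{d+1}, …, M_2`, for every `M' ∈ M`
        ∀ M' ∈ M,
          (∀ g g' : M' ⟶ N (d + 1), g ≫ φ d = g' ≫ φ d → g = g') ∧
          ∀ j, 1 ≤ j → j < d → ∀ g : M' ⟶ N (j + 1), g ≫ φ j = 0 →
            ∃ h : M' ⟶ N (j + 2), h ≫ φ (j + 1) = g := by
  have A (X : E) : RightApprox M X := (nonempty_rightApprox (happrox₂ X)).some
  have hw (k : ℕ) : (approxSeq A (Arrow.mk f) (k + 1)).hom ≫ (approxSeq A (Arrow.mk f) k).hom = 0 :=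
    comp_kernel_ι_comp _ _
  have hmono : Mono (approxSeq A (Arrow.mk f) d).hom := by
    obtain ⟨d, rfl⟩ := Nat.exists_eq_add_of_le' hd
    have hK : kernel (approxSeq A (Arrow.mk f) d).hom ∈ M :=
      (hortho₁ _).2 fun Y hY i hi hid =>
        subsingleton_ext_kernel_approxSeq A (Arrow.mk f) (fun X hX => (hortho₁ X).1 hX)
          d hY i hi (by omega) hid
    have := (A _).isIso hK
    exact mono_comp (A (kernel (approxSeq A (Arrow.mk f) d).hom)).hom (kernel.ι _)
  refine ⟨fun k => (approxSeq A (Arrow.mk f) k).right, fun k => (approxSeq A (Arrow.mk f) k).hom,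
    Iso.refl _, Iso.refl _, ?_, ?_, fun k _ => hw k, hmono, ?_, ?_⟩
  · exact ((Category.id_comp _).trans (Category.comp_id f)).symm
  · rintro (_ | _ | k) -
    · exact hM₀
    · exact hM₁
    · exact (A (kernel (approxSeq A (Arrow.mk f) k).hom)).mem
  · intro j _
    have := (A (kernel (approxSeq A (Arrow.mk f) j).hom)).epi
    exact exact_comp_kernel_ι (approxSeq A (Arrow.mk f) j).hom (A _).hom
  · intro M' hM'
    refine ⟨fun g g' h => (cancel_mono (approxSeq A (Arrow.mk f) d).hom).1 h, fun j _ _ g hg => ?_⟩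
    exact exists_comp_kernel_ι_eq _ _ ((A _).lift M' hM') g hg

end AuslanderIyamaStmt12
end
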